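/- (Lemma 7.6, Lee-Yang type theorem for the Blume-Capel partition function.) Let β > 0 and Δ ≥ −log 4. Let G = (V,E) be a finite graph, A ⊂ V, and let h : V → ℂ be a complex magnetic field such that Re(h_x) ≥ |Im(h_x)| for every x ∈ V. Then the restricted partition function Z^h_{G,β,Δ}[σ_A ≠ 0] := Σ_{σ ∈ {-1,0,1}^V, σ_x ≠ 0 for all x∈A} exp( β Σ_{xy∈E} σ_x σ_y + Δ Σ_{x∈V} σ_x² + Σ_{x∈V} h_x σ_x ) is nonzero. -/

import Mathlib

namespace LeeYangBC

/-- Spins: `0, 1, 2 : Fin 3` encode the values `-1, 0, +1`. -/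
abbrev Spin := Fin 3

/-- The real value of a spin. -/
def sval (s : Spin) : ℝ := ((s : ℕ) : ℝ) - 1

open scoped ComplexOrder NNReal ComplexConjugate

/-- The single-site weight `exp (Δ s²)`, set to zero at `s = 0` on the set `A`. -/
noncomputable def siteWeight {V : Type*} [DecidableEq V] (A : Finset V) (Δ : ℝ) (x : V)
    (s : Spin) : ℝ :=
  if x ∈ A → s ≠ 1 then Real.exp (Δ * sval s ^ 2) else 0

/-- The complex variable `(1 - i) (s + i t)` attached to a pair of spins `(s, t)`. -/
noncomputable def pairVar (p : Spin × Spin) : ℂ :=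
  (1 - Complex.I) * ((sval p.1 : ℂ) + Complex.I * (sval p.2 : ℂ))

lemma sval_zero : sval 0 = -1 := by simp [sval]

lemma sval_one : sval 1 = 0 := by simp [sval]

lemma sval_two : sval 2 = 1 := by simp [sval]; norm_num

/-- A sum over pairs of spins of an even weight, written out over the values of `pairVar`. -/
lemma sum_pairVar (a b c : ℂ) (w : Spin → ℂ) (h0 : w 0 = a) (h1 : w 1 = b) (h2 : w 2 = a)
    (hc : b * b = c) (f : ℂ → ℂ) :
    ∑ p : Spin × Spin, w p.1 * w p.2 * f (pairVar p) =
      a * a * (f 2 + f (2 * Complex.I) + f (-2) + f (-2 * Complex.I)) +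
      a * b * (f (1 + Complex.I) + f (-1 + Complex.I) + f (-1 - Complex.I) + f (1 - Complex.I)) +
      c * f 0 := by
  have e00 : pairVar (0, 0) = -2 := by
    simp only [pairVar, sval_zero]; push_cast; linear_combination (Complex.I_sq)
  have e01 : pairVar (0, 1) = -1 + Complex.I := by
    simp only [pairVar, sval_zero, sval_one]; push_cast; ring
  have e02 : pairVar (0, 2) = 2 * Complex.I := by
    simp only [pairVar, sval_zero, sval_two]; push_cast; linear_combination (-Complex.I_sq)
  have e10 : pairVar (1, 0) = -1 - Complex.I := by
    simp only [pairVar, sval_zero, sval_one]; push_cast; linear_combination (Complex.I_sq)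
  have e11 : pairVar (1, 1) = 0 := by
    simp only [pairVar, sval_one]; push_cast; ring
  have e12 : pairVar (1, 2) = 1 + Complex.I := by
    simp only [pairVar, sval_two, sval_one]; push_cast; linear_combination (-Complex.I_sq)
  have e20 : pairVar (2, 0) = -2 * Complex.I := by
    simp only [pairVar, sval_zero, sval_two]; push_cast; linear_combination (Complex.I_sq)
  have e21 : pairVar (2, 1) = 1 - Complex.I := by
    simp only [pairVar, sval_two, sval_one]; push_cast; ring
  have e22 : pairVar (2, 2) = 2 := by
    simp only [pairVar, sval_two]; push_cast; linear_combination (-Complex.I_sq)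
  simp only [Fintype.sum_prod_type, Fin.sum_univ_three, e00, e01, e02, e10, e11, e12, e20, e21,
    e22, h0, h1, h2, ← hc]
  ring

lemma moment_nonneg_of_even_weight (a b : ℝ) (ha : 1 / 4 ≤ a) (hb : 0 ≤ b) (hb1 : b ≤ 1)
    (w : Spin → ℝ) (h0 : w 0 = a) (h1 : w 1 = b) (h2 : w 2 = a) (n d : ℕ) :
    0 ≤ ∑ p : Spin × Spin, (w p.1 : ℂ) * (w p.2 : ℂ) *
      (pairVar p ^ (n + d) * conj (pairVar p) ^ n) := by
  have hI2 : Complex.I ^ 2 = -1 := Complex.I_sq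
  have hI3 : Complex.I ^ 3 = -Complex.I := Complex.I_pow_three
  have hI4 : Complex.I ^ 4 = 1 := Complex.I_pow_four
  rw [sum_pairVar (a : ℂ) (b : ℂ) ((b * b : ℝ) : ℂ) (fun s => (w s : ℂ)) (by simp [h0])
    (by simp [h1]) (by simp [h2]) (by push_cast; rfl) (fun z => z ^ (n + d) * conj z ^ n)]
  obtain ⟨k, r, hr, rfl⟩ : ∃ k r, r < 4 ∧ d = 4 * k + r :=
    ⟨d / 4, d % 4, Nat.mod_lt _ (by norm_num), by omega⟩
  have key : ∀ z : ℂ, z ^ (n + (4 * k + r)) * conj z ^ n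
      = (z * conj z) ^ n * (z ^ 4) ^ k * z ^ r := by
    intro z; rw [pow_add, pow_add, pow_mul, mul_pow]; ring
  simp only [key]
  simp only [map_add, map_sub, map_mul, map_neg, map_one, map_ofNat, Complex.conj_I]
  have q1 : (2 * Complex.I) * (2 * -Complex.I) = 4 := by linear_combination (-4) * hI2
  have q2 : (-2 * Complex.I) * (-2 * -Complex.I) = 4 := by linear_combination (-4) * hI2
  have q3 : (1 + Complex.I) * (1 + -Complex.I) = 2 := by linear_combination -hI2
  have q4 : (-1 + Complex.I) * (-1 + -Complex.I) = 2 := by linear_combination -hI2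
  have q5 : (-1 - Complex.I) * (-1 - -Complex.I) = 2 := by linear_combination -hI2
  have q6 : (1 - Complex.I) * (1 - -Complex.I) = 2 := by linear_combination -hI2
  have f1 : (2 * Complex.I) ^ 4 = 16 := by linear_combination 16 * hI4
  have f2 : (-2 * Complex.I) ^ 4 = 16 := by linear_combination 16 * hI4
  have f3 : (1 + Complex.I) ^ 4 = -4 := by
    linear_combination hI4 + 4 * hI3 + 6 * hI2
  have f4 : (-1 + Complex.I) ^ 4 = -4 := by
    linear_combination hI4 - 4 * hI3 + 6 * hI2
  have f5 : (-1 - Complex.I) ^ 4 = -4 := by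
    linear_combination hI4 + 4 * hI3 + 6 * hI2
  have f6 : (1 - Complex.I) ^ 4 = -4 := by
    linear_combination hI4 - 4 * hI3 + 6 * hI2
  have q7 : (2 : ℂ) * 2 = 4 := by norm_num
  have q8 : (-2 : ℂ) * -2 = 4 := by norm_num
  have f7 : (2 : ℂ) ^ 4 = 16 := by norm_num
  have f8 : (-2 : ℂ) ^ 4 = 16 := by norm_num
  rw [q1, q2, q3, q4, q5, q6, q7, q8, f1, f2, f3, f4, f5, f6, f7, f8]
  have hz : (0 : ℂ) ≤ ((b * b : ℝ) : ℂ) *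
      ((0 * conj (0 : ℂ)) ^ n * (0 ^ 4) ^ k * 0 ^ r) := by
    have : (0 * conj (0 : ℂ)) ^ n * (0 ^ 4) ^ k * 0 ^ r
        = (((0 : ℝ) ^ n * (0 ^ 4) ^ k * 0 ^ r : ℝ) : ℂ) := by push_cast; simp
    rw [this, ← Complex.ofReal_mul, Complex.zero_le_real]
    positivity
  refine add_nonneg ?_ hz
  have hr0 : r = 0 ∨ r = 1 ∨ r = 2 ∨ r = 3 := by omega
  rcases hr0 with rfl | rfl | rfl | rfl
  · have hk : 0 ≤ a * (4 ^ n * 16 ^ k) + b * (2 ^ n * (-4 : ℝ) ^ k) := by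
      have h2n : (0 : ℝ) < 2 ^ n := by positivity
      have h4n : (2 : ℝ) ^ n ≤ 4 ^ n := by gcongr; norm_num
      rcases Nat.eq_zero_or_pos k with rfl | hk
      · have : 0 ≤ a := by linarith
        simp; positivity
      · obtain ⟨j, rfl⟩ : ∃ j, k = j + 1 := ⟨k - 1, by omega⟩
        have h4 : -(4 : ℝ) ^ (j + 1) ≤ (-4) ^ (j + 1) := by
          have := neg_abs_le ((-4 : ℝ) ^ (j + 1))
          rwa [abs_pow, abs_neg, abs_of_pos (by norm_num : (0 : ℝ) < 4)] at this
        have h16 : (4 : ℝ) ^ (j + 1) ≤ 1 / 4 * 16 ^ (j + 1) := by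
          have : (4 : ℝ) ^ j ≤ 16 ^ j := by gcongr; norm_num
          rw [pow_succ, pow_succ]; linarith
        have hA : 2 ^ n * 4 ^ (j + 1) ≤ a * (4 ^ n * 16 ^ (j + 1)) := by
          calc (2 : ℝ) ^ n * 4 ^ (j + 1) ≤ 4 ^ n * (1 / 4 * 16 ^ (j + 1)) := by gcongr
            _ = 1 / 4 * (4 ^ n * 16 ^ (j + 1)) := by ring
            _ ≤ _ := by gcongr
        have hB : b * (2 ^ n * 4 ^ (j + 1)) ≤ 1 * (2 ^ n * 4 ^ (j + 1)) := by gcongr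
        have hC := mul_le_mul_of_nonneg_left h4 (mul_nonneg hb h2n.le)
        nlinarith
    have : (a : ℂ) * a * (4 ^ n * 16 ^ k * 2 ^ 0 + 4 ^ n * 16 ^ k * (2 * Complex.I) ^ 0
          + 4 ^ n * 16 ^ k * (-2) ^ 0 + 4 ^ n * 16 ^ k * (-2 * Complex.I) ^ 0)
        + a * b * (2 ^ n * (-4) ^ k * (1 + Complex.I) ^ 0
          + 2 ^ n * (-4) ^ k * (-1 + Complex.I) ^ 0
          + 2 ^ n * (-4) ^ k * (-1 - Complex.I) ^ 0 + 2 ^ n * (-4) ^ k * (1 - Complex.I) ^ 0)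
        = ((4 * a * (a * (4 ^ n * 16 ^ k) + b * (2 ^ n * (-4 : ℝ) ^ k)) : ℝ) : ℂ) := by
      push_cast; ring
    rw [this, Complex.zero_le_real]
    have : 0 ≤ a := by linarith
    positivity
  · apply le_of_eq; ring
  · apply le_of_eq
    linear_combination (-8 * (a : ℂ) * a * 4 ^ n * 16 ^ k
      - 4 * (a : ℂ) * b * 2 ^ n * (-4) ^ k) * hI2
  · apply le_of_eq; ring

/-- Polynomials with nonnegative coefficients in the variables `pairVar` and their conjugates. -/
noncomputable def positivePolynomials (V : Type*) : Subalgebra ℝ≥0 ((V → Spin × Spin) → ℂ) :=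
  Algebra.adjoin ℝ≥0 (Set.range (fun (x : V) ω => pairVar (ω x)) ∪
    Set.range (fun (x : V) ω => conj (pairVar (ω x))))

lemma pairVar_mem {V : Type*} (x : V) :
    (fun ω : V → Spin × Spin => pairVar (ω x)) ∈ positivePolynomials V :=
  Algebra.subset_adjoin (Or.inl ⟨x, rfl⟩)

lemma conj_pairVar_mem {V : Type*} (x : V) :
    (fun ω : V → Spin × Spin => conj (pairVar (ω x))) ∈ positivePolynomials V :=
  Algebra.subset_adjoin (Or.inr ⟨x, rfl⟩)

lemma ofReal_mul_mem {V : Type*} {F : (V → Spin × Spin) → ℂ} (hF : F ∈ positivePolynomials V) {r : ℝ}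
    (hr : 0 ≤ r) : (fun ω => (r : ℂ) * F ω) ∈ positivePolynomials V :=
  Subalgebra.smul_mem _ hF (⟨r, hr⟩ : ℝ≥0)

section Weight

variable {V : Type*} [DecidableEq V] (A : Finset V) (Δ : ℝ)

lemma siteWeight_nonneg (x : V) (s : Spin) : 0 ≤ siteWeight A Δ x s := by
  unfold siteWeight; split_ifs <;> positivity

lemma siteWeight_zero (x : V) : siteWeight A Δ x 0 = Real.exp Δ := by
  simp [siteWeight, sval_zero]

lemma siteWeight_two (x : V) : siteWeight A Δ x 2 = Real.exp Δ := by
  simp [siteWeight, sval_two]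

lemma siteWeight_one_le_one (x : V) : siteWeight A Δ x 1 ≤ 1 := by
  unfold siteWeight; split_ifs <;> simp [sval_one]

lemma moment_nonneg (hΔ : -Real.log 4 ≤ Δ) (x : V) (m n : ℕ) :
    0 ≤ ∑ p : Spin × Spin, (siteWeight A Δ x p.1 : ℂ) * (siteWeight A Δ x p.2 : ℂ) *
      (pairVar p ^ m * conj (pairVar p) ^ n) := by
  have ha : 1 / 4 ≤ Real.exp Δ := by
    calc (1 / 4 : ℝ) = Real.exp (-Real.log 4) := by
          rw [Real.exp_neg, Real.exp_log (by norm_num)]; norm_num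
      _ ≤ _ := Real.exp_le_exp.2 hΔ
  have main := moment_nonneg_of_even_weight (Real.exp Δ) (siteWeight A Δ x 1) ha
    (siteWeight_nonneg A Δ x 1) (siteWeight_one_le_one A Δ x) (siteWeight A Δ x)
    (siteWeight_zero A Δ x) rfl (siteWeight_two A Δ x)
  rcases le_total n m with hnm | hnm
  · obtain ⟨d, rfl⟩ := Nat.exists_eq_add_of_le hnm
    exact main n d
  · obtain ⟨d, rfl⟩ := Nat.exists_eq_add_of_le hnm
    have h := star_nonneg_iff.2 (main m d)
    simpa [mul_comm] using h

variable [Fintype V]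

/-- The unnormalised expectation of an observable on pairs of configurations. -/
noncomputable def pairSum (F : (V → Spin × Spin) → ℂ) : ℂ :=
  ∑ ω, (∏ x, ((siteWeight A Δ x (ω x).1 : ℂ) * (siteWeight A Δ x (ω x).2 : ℂ))) * F ω

lemma pairSum_monomial_nonneg (hΔ : -Real.log 4 ≤ Δ) (m n : V → ℕ) :
    0 ≤ pairSum A Δ (fun ω => ∏ x, (pairVar (ω x) ^ m x * conj (pairVar (ω x)) ^ n x)) := by
  have h : pairSum A Δ (fun ω => ∏ x, (pairVar (ω x) ^ m x * conj (pairVar (ω x)) ^ n x)) =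
      ∏ x, ∑ p : Spin × Spin, (siteWeight A Δ x p.1 : ℂ) * (siteWeight A Δ x p.2 : ℂ) *
        (pairVar p ^ m x * conj (pairVar p) ^ n x) := by
    simp only [pairSum, ← Finset.prod_mul_distrib]
    rw [Finset.prod_univ_sum, Fintype.piFinset_univ]
  rw [h]
  exact Finset.prod_nonneg fun x _ => moment_nonneg A Δ hΔ x _ _

lemma pairSum_nonneg (hΔ : -Real.log 4 ≤ Δ) {F : (V → Spin × Spin) → ℂ}
    (hF : F ∈ positivePolynomials V) : 0 ≤ pairSum A Δ F := by
  have hF' : F ∈ Submodule.span ℝ≥0 (Submonoid.closure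
      (Set.range (fun (x : V) (ω : V → Spin × Spin) => pairVar (ω x)) ∪
        Set.range (fun (x : V) ω => conj (pairVar (ω x)))) : Set ((V → Spin × Spin) → ℂ)) := by
    rw [← Algebra.adjoin_eq_span]; exact hF
  clear hF
  induction hF' using Submodule.span_induction with
  | mem F h =>
    obtain ⟨m, n, rfl⟩ : ∃ m n : V → ℕ,
        F = fun ω => ∏ x, (pairVar (ω x) ^ m x * conj (pairVar (ω x)) ^ n x) := by
      induction h using Submonoid.closure_induction with
      | mem F h =>
        rcases h with ⟨x, rfl⟩ | ⟨x, rfl⟩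
        · refine ⟨Pi.single x 1, 0, ?_⟩
          ext ω
          rw [Finset.prod_eq_single x] <;> simp +contextual
        · refine ⟨0, Pi.single x 1, ?_⟩
          ext ω
          rw [Finset.prod_eq_single x] <;> simp +contextual
      | one => exact ⟨0, 0, by ext; simp⟩
      | mul F G _ _ hF hG =>
        obtain ⟨m, n, rfl⟩ := hF
        obtain ⟨m', n', rfl⟩ := hG
        refine ⟨m + m', n + n', ?_⟩
        ext ω
        simp only [Pi.mul_apply, Pi.add_apply, ← Finset.prod_mul_distrib]
        exact Finset.prod_congr rfl fun x _ => by ring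
    exact pairSum_monomial_nonneg A Δ hΔ m n
  | zero => simp [pairSum]
  | add F G hF hG h1 h2 =>
    have : pairSum A Δ (F + G) = pairSum A Δ F + pairSum A Δ G := by
      simp [pairSum, mul_add, Finset.sum_add_distrib]
    rw [this]
    exact add_nonneg h1 h2
  | smul r F hF h =>
    have : pairSum A Δ (r • F) = ((r : ℝ) : ℂ) * pairSum A Δ F := by
      simp only [pairSum, Finset.mul_sum]
      refine Finset.sum_congr rfl fun ω _ => ?_
      have : (r • F) ω = ((r : ℝ) : ℂ) * F ω := rfl
      rw [this]; ring
    rw [this]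
    exact mul_nonneg (Complex.zero_le_real.2 r.2) h

lemma pairSum_one_re_pos : 0 < (pairSum A Δ 1).re := by
  have h : pairSum A Δ 1 = ((∑ ω : V → Spin × Spin,
      ∏ x, (siteWeight A Δ x (ω x).1 * siteWeight A Δ x (ω x).2) : ℝ) : ℂ) := by
    simp [pairSum]
  rw [h, Complex.ofReal_re]
  refine Finset.sum_pos' (fun ω _ => Finset.prod_nonneg fun x _ =>
    mul_nonneg (siteWeight_nonneg ..) (siteWeight_nonneg ..))
    ⟨fun _ => (0, 0), Finset.mem_univ _, Finset.prod_pos fun x _ => ?_⟩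
  simp only [siteWeight_zero]
  positivity

lemma pairSum_exp_ne_zero (hΔ : -Real.log 4 ≤ Δ) {F : (V → Spin × Spin) → ℂ}
    (hF : F ∈ positivePolynomials V) : pairSum A Δ (fun ω => Complex.exp (F ω)) ≠ 0 := by
  have hs : HasSum (fun k : ℕ => pairSum A Δ (fun ω => F ω ^ k / (k.factorial : ℂ)))
      (pairSum A Δ (fun ω => Complex.exp (F ω))) := by
    refine hasSum_sum fun ω _ => HasSum.mul_left _ ?_
    rw [Complex.exp_eq_exp_ℂ]
    exact NormedSpace.expSeries_div_hasSum_exp (F ω)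
  have hnn : ∀ k : ℕ, 0 ≤ pairSum A Δ (fun ω => F ω ^ k / (k.factorial : ℂ)) := by
    intro k
    refine pairSum_nonneg A Δ hΔ ?_
    convert ofReal_mul_mem (pow_mem hF k) (r := (k.factorial : ℝ)⁻¹) (by positivity) using 2
    simp [div_eq_inv_mul]
  have hre := Complex.hasSum_re hs
  have hle := le_hasSum hre 0 (fun k _ => (Complex.le_def.1 (hnn k)).1)
  have h0 : (fun ω => F ω ^ 0 / ((Nat.factorial 0 : ℕ) : ℂ)) = 1 := by ext; simp
  simp only [h0] at hle
  intro hz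
  rw [hz] at hle
  exact absurd (pairSum_one_re_pos A Δ) (not_lt.2 hle)

end Weight

section Exponent

variable {V : Type*}

/-- The interaction energy carried by an unordered pair of vertices. -/
noncomputable def edgeTerm (σ : V → Spin) (e : Sym2 V) : ℝ :=
  Sym2.lift ⟨fun x y => sval (σ x) * sval (σ y), fun _ _ => mul_comm _ _⟩ e

lemma edgeTerm_pair_mem {β : ℝ} (hβ : 0 ≤ β) (e : Sym2 V) :
    (fun ω : V → Spin × Spin => ((β : ℂ) * ((edgeTerm (fun x => (ω x).1) e : ℂ) +
      (edgeTerm (fun x => (ω x).2) e : ℂ)))) ∈ positivePolynomials V := by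
  induction e using Sym2.ind with
  | _ x y =>
    have hm := ofReal_mul_mem (add_mem (mul_mem (pairVar_mem x) (conj_pairVar_mem y))
      (mul_mem (conj_pairVar_mem x) (pairVar_mem y))) (r := β / 4) (by positivity)
    convert hm using 2
    rename_i ω
    simp only [edgeTerm, Sym2.lift_mk, Pi.add_apply, Pi.mul_apply, pairVar, map_mul, map_sub,
      map_add, map_one, Complex.conj_I, Complex.conj_ofReal]
    push_cast
    generalize (sval (ω x).1 : ℂ) = a
    generalize (sval (ω x).2 : ℂ) = b
    generalize (sval (ω y).1 : ℂ) = c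
    generalize (sval (ω y).2 : ℂ) = d
    linear_combination (β : ℂ) / 2 * (a * c + b * d * (2 - Complex.I ^ 2)) * Complex.I_sq

lemma field_pair_mem {z : ℂ} (hz : |z.im| ≤ z.re) (x : V) :
    (fun ω : V → Spin × Spin => z * (sval (ω x).1 : ℂ) + conj z * (sval (ω x).2 : ℂ)) ∈
      positivePolynomials V := by
  obtain ⟨h1, h2⟩ := abs_le.1 hz
  have hm := add_mem (ofReal_mul_mem (pairVar_mem x) (r := (z.re - z.im) / 2) (by linarith))
    (ofReal_mul_mem (conj_pairVar_mem x) (r := (z.re + z.im) / 2) (by linarith))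
  convert hm using 1
  ext1 ω
  obtain ⟨c, d⟩ := z
  have e1 : (⟨c, d⟩ : ℂ) = c + d * Complex.I := Complex.mk_eq_add_mul_I c d
  simp only [pairVar, Pi.add_apply, e1, map_mul, map_sub, map_add, map_one, Complex.conj_I,
    Complex.conj_ofReal]
  push_cast
  linear_combination ((c : ℂ) * (sval (ω x).2 : ℂ)) * Complex.I_sq

variable [Fintype V]

/-- The exponent of the Gibbs weight without its crystal field term. -/
noncomputable def exponent (E : Finset (Sym2 V)) (β : ℝ) (h : V → ℂ) (σ : V → Spin) : ℂ :=
  ((β * ∑ e ∈ E, edgeTerm σ e : ℝ) : ℂ) + ∑ x, h x * (sval (σ x) : ℂ)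

lemma exponent_pair_mem (E : Finset (Sym2 V)) {β : ℝ} (hβ : 0 ≤ β) {h : V → ℂ}
    (hh : ∀ x, |(h x).im| ≤ (h x).re) :
    (fun ω : V → Spin × Spin => exponent E β h (fun x => (ω x).1) +
      conj (exponent E β h (fun x => (ω x).2))) ∈ positivePolynomials V := by
  have hm := add_mem (sum_mem fun e (_ : e ∈ E) => edgeTerm_pair_mem hβ e)
    (sum_mem fun x (_ : x ∈ Finset.univ) => field_pair_mem (hh x) x)
  convert hm using 1
  ext ω
  simp only [exponent, map_add, map_sum, map_mul, Complex.conj_ofReal, Pi.add_apply,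
    Finset.sum_apply, Finset.sum_add_distrib, ← Finset.mul_sum]
  push_cast
  ring

variable [DecidableEq V]

lemma restricted_weight_eq (E : Finset (Sym2 V)) (A : Finset V) (β Δ : ℝ) (h : V → ℂ)
    (σ : V → Spin) :
    (if ∀ x ∈ A, σ x ≠ 1 then
      Complex.exp (((β * ∑ e ∈ E, edgeTerm σ e + Δ * ∑ x : V, sval (σ x) ^ 2 : ℝ) : ℂ)
        + ∑ x : V, h x * (sval (σ x) : ℂ)) else 0) =
      ((∏ x, siteWeight A Δ x (σ x) : ℝ) : ℂ) * Complex.exp (exponent E β h σ) := by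
  have hp : ∏ x, siteWeight A Δ x (σ x) =
      if ∀ x ∈ A, σ x ≠ 1 then Real.exp (Δ * ∑ x : V, sval (σ x) ^ 2) else 0 := by
    simp only [siteWeight, Fintype.prod_ite_zero, Finset.mul_sum, Real.exp_sum]
  rw [hp]
  split_ifs
  · rw [Complex.ofReal_exp, ← Complex.exp_add, exponent]
    congr 1
    push_cast
    ring
  · simp

lemma partition_mul_conj (E : Finset (Sym2 V)) (A : Finset V) (β Δ : ℝ) (h : V → ℂ) :
    (∑ σ : V → Spin, ((∏ x, siteWeight A Δ x (σ x) : ℝ) : ℂ) * Complex.exp (exponent E β h σ)) *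
      conj (∑ σ : V → Spin,
        ((∏ x, siteWeight A Δ x (σ x) : ℝ) : ℂ) * Complex.exp (exponent E β h σ)) =
      pairSum A Δ (fun ω => Complex.exp (exponent E β h (fun x => (ω x).1) +
        conj (exponent E β h (fun x => (ω x).2)))) := by
  rw [map_sum, Finset.sum_mul_sum, ← Fintype.sum_prod_type', pairSum,
    ← (Equiv.arrowProdEquivProdArrow V (fun _ => Spin) (fun _ => Spin)).sum_comp]
  refine Finset.sum_congr rfl fun ω _ => ?_
  simp only [Equiv.arrowProdEquivProdArrow, Equiv.coe_fn_mk, Finset.prod_mul_distrib, map_mul,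
    map_prod, Complex.conj_ofReal, ← Complex.exp_conj, Complex.exp_add, Complex.ofReal_prod]
  ring

end Exponent

/-- **Lemma 7.6** (Lee–Yang type theorem for the Blume–Capel partition function).
Let `β > 0` and `Δ ≥ -log 4`.  Let `G = (V,E)` be a finite (simple) graph, `A ⊆ V`, and
let `h : V → ℂ` be a complex magnetic field with `Re(h_x) ≥ |Im(h_x)|` for every `x`.
Then the restricted partition function
`Z^h_{G,β,Δ}[σ_A ≠ 0] = Σ_{σ ∈ {-1,0,1}^V, σ_x ≠ 0 ∀x∈A}
   exp(β Σ_{xy∈E} σ_x σ_y + Δ Σ_{x∈V} σ_x² + Σ_{x∈V} h_x σ_x)`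
is nonzero.  (The spin value `0` is encoded by `1 : Fin 3`.) -/
theorem lee_yang_nonvanishing {V : Type*} [Fintype V] [DecidableEq V]
    (E : Finset (Sym2 V)) (hE : ∀ e ∈ E, ¬ e.IsDiag)
    (A : Finset V) (β Δ : ℝ) (hβ : 0 < β) (hΔ : -Real.log 4 ≤ Δ)
    (h : V → ℂ) (hh : ∀ x : V, |(h x).im| ≤ (h x).re) :
    (∑ σ : V → Spin,
        if ∀ x ∈ A, σ x ≠ 1 then
          Complex.exp
            ((↑(β * ∑ e ∈ E,
                Sym2.lift ⟨fun x y => sval (σ x) * sval (σ y),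
                  fun _ _ => mul_comm _ _⟩ e
              + Δ * ∑ x : V, sval (σ x) ^ 2) : ℂ)
              + ∑ x : V, h x * (sval (σ x) : ℂ))
        else 0) ≠ 0 := by
  intro hZ
  refine pairSum_exp_ne_zero A Δ hΔ (exponent_pair_mem E hβ.le hh) ?_
  rw [← partition_mul_conj, ← Finset.sum_congr rfl fun σ _ => restricted_weight_eq E A β Δ h σ]
  exact mul_eq_zero_of_left hZ _

end LeeYangBC
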